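/- Let U be a unitary complex n×n matrix. Then the Schur factorization of U is uniquely determined and equals U = I_n · U · I_n: that is, if (F, W, G) is a Schur factorization of U, then F = I_n, G = I_n and W = U. -/

import Mathlib

open Matrix
open scoped ComplexOrder

noncomputable section

namespace MatFact

/-- ℓ² norm of a complex vector. -/
def vnorm {n : ℕ} (v : Fin n → ℂ) : ℝ := Real.sqrt (∑ j, ‖v j‖ ^ 2)

/-- Operator norm of a matrix as a map ℓ²(Fin n) → ℓ²(Fin m). -/
def opNorm {m n : ℕ} (X : Matrix (Fin m) (Fin n) ℂ) : ℝ :=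
  sSup {c : ℝ | ∃ v : Fin n → ℂ, vnorm v ≤ 1 ∧ c = vnorm (X.mulVec v)}

/-- Column norm: the maximal ℓ² norm of a column. -/
def colNorm {m n : ℕ} (X : Matrix (Fin m) (Fin n) ℂ) : ℝ :=
  ⨆ j : Fin n, vnorm (fun i => X i j)

/-- Hilbert–Schmidt (Frobenius) norm. -/
def frobNorm {m n : ℕ} (X : Matrix (Fin m) (Fin n) ℂ) : ℝ :=
  Real.sqrt (∑ i, ∑ j, ‖X i j‖ ^ 2)

/-- Schur norm: operator norm of Schur (entrywise) multiplication by `X`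
on matrices with the operator norm. -/
def schurNorm {m n : ℕ} (X : Matrix (Fin m) (Fin n) ℂ) : ℝ :=
  sSup {c : ℝ | ∃ A : Matrix (Fin m) (Fin n) ℂ, opNorm A ≤ 1 ∧
    c = opNorm (Matrix.hadamard X A)}

/-- The T-norm (bilinear Schur norm). -/
def Tnorm {m n : ℕ} (X : Matrix (Fin m) (Fin n) ℂ) : ℝ :=
  sSup {c : ℝ | ∃ (a : Fin m → ℂ) (B : Matrix (Fin m) (Fin n) ℂ),
    (∀ i, ‖a i‖ ≤ 1) ∧ opNorm B ≤ 1 ∧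
    c = vnorm (fun j => ∑ i, a i * X i j * B i j)}

/-- The F-norm: operator norm of `X` from `ℂⁿ` with the sup norm to `ℂᵐ`
with the ℓ² norm. -/
def Fnorm {m n : ℕ} (X : Matrix (Fin m) (Fin n) ℂ) : ℝ :=
  sSup {c : ℝ | ∃ v : Fin n → ℂ, (∀ j, ‖v j‖ ≤ 1) ∧ c = vnorm (X.mulVec v)}

/-- The bilinear form norm. -/
def Bnorm {m n : ℕ} (Y : Matrix (Fin m) (Fin n) ℂ) : ℝ :=
  sSup {c : ℝ | ∃ (a : Fin m → ℂ) (b : Fin n → ℂ), (∀ i, ‖a i‖ ≤ 1) ∧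
    (∀ j, ‖b j‖ ≤ 1) ∧ c = ‖∑ i, ∑ j, Y i j * a i * b j‖}

/-- The completely bounded F-norm. -/
def cbF {m n : ℕ} (X : Matrix (Fin m) (Fin n) ℂ) : ℝ :=
  sInf {c : ℝ | ∃ (A : Matrix (Fin m) (Fin n) ℂ) (ξ : Fin n → ℂ),
    X = A * Matrix.diagonal ξ ∧ c = opNorm A * vnorm ξ}

/-- The completely bounded bilinear form norm. -/
def cbB {m n : ℕ} (X : Matrix (Fin m) (Fin n) ℂ) : ℝ :=
  sInf {c : ℝ | ∃ (η : Fin m → ℂ) (B : Matrix (Fin m) (Fin n) ℂ) (ξ : Fin n → ℂ),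
    X = Matrix.diagonal η * B * Matrix.diagonal ξ ∧
    c = vnorm η * opNorm B * vnorm ξ}

/-- The range (column space) of a matrix, as a submodule of `ℂᵐ`. -/
def ran {m n : ℕ} (X : Matrix (Fin m) (Fin n) ℂ) : Submodule ℂ (Fin m → ℂ) :=
  LinearMap.range X.mulVecLin

/-- `P` is the orthogonal projection onto the subspace `E`, i.e. `P` is a
Hermitian idempotent with range `E`. -/
def IsOrthProjOnto {n : ℕ} (P : Matrix (Fin n) (Fin n) ℂ)
    (E : Submodule ℂ (Fin n → ℂ)) : Prop :=
  P.IsHermitian ∧ P * P = P ∧ ran P = E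

/-- `W` is a partial isometry with support `E` and range `F`. -/
def IsPartialIsometryFromTo {m n : ℕ} (W : Matrix (Fin m) (Fin n) ℂ)
    (E : Submodule ℂ (Fin n → ℂ)) (F : Submodule ℂ (Fin m → ℂ)) : Prop :=
  IsOrthProjOnto (Wᴴ * W) E ∧ IsOrthProjOnto (W * Wᴴ) F

/-- A cb operator factorization of `X`. -/
def IsCbOpFact {m n : ℕ} (X A : Matrix (Fin m) (Fin n) ℂ) (ξ : Fin n → ℂ) : Prop :=
  (∀ j, 0 ≤ ξ j) ∧ vnorm ξ = 1 ∧ opNorm A = cbF X ∧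
  (∀ j, ξ j = 0 → ∀ i, A i j = 0) ∧ X = A * Matrix.diagonal ξ

/-- A cb bilinear form factorization of `X`. -/
def IsCbBilFact {m n : ℕ} (X : Matrix (Fin m) (Fin n) ℂ) (η : Fin m → ℂ)
    (B : Matrix (Fin m) (Fin n) ℂ) (ξ : Fin n → ℂ) : Prop :=
  (∀ i, 0 ≤ η i) ∧ (∀ j, 0 ≤ ξ j) ∧ vnorm η = 1 ∧ vnorm ξ = 1 ∧
  opNorm B = cbB X ∧ (∀ j, ξ j = 0 → ∀ i, B i j = 0) ∧
  (∀ i, η i = 0 → ∀ j, B i j = 0) ∧ X = Matrix.diagonal η * B * Matrix.diagonal ξ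

/-- A Schur factorization of `X`. -/
def IsSchurFact {m n : ℕ} (X : Matrix (Fin m) (Fin n) ℂ)
    (F : Matrix (Fin m) (Fin m) ℂ) (W : Matrix (Fin m) (Fin n) ℂ)
    (G : Matrix (Fin n) (Fin n) ℂ) : Prop :=
  F.PosSemidef ∧ (∀ i, (F * F) i i ≤ 1) ∧ G.PosSemidef ∧ (∀ j, (G * G) j j ≤ 1) ∧
  IsPartialIsometryFromTo W (ran G) (ran F) ∧
  X = (schurNorm X : ℂ) • (F * W * G)

/-- A bilinear Schur factorization of `X`. -/
def IsBilinSchurFact {m n : ℕ} (X : Matrix (Fin m) (Fin n) ℂ)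
    (T : Matrix (Fin m) (Fin m) ℂ) (W : Matrix (Fin m) (Fin n) ℂ)
    (G : Matrix (Fin n) (Fin n) ℂ) : Prop :=
  T.PosSemidef ∧ frobNorm T = Tnorm X ∧ G.PosSemidef ∧ (∀ j, (G * G) j j ≤ 1) ∧
  IsPartialIsometryFromTo W (ran G) (ran T) ∧ X = T * W * G

/-- Maximal diagonal entry (real part) of a square matrix. -/
def maxDiag {n : ℕ} (P : Matrix (Fin n) (Fin n) ℂ) : ℝ := ⨆ i, (P i i).re

end MatFact

namespace MatFact

lemma vnorm_eq_norm_toLp {n : ℕ} (v : Fin n → ℂ) : vnorm v = ‖WithLp.toLp 2 v‖ := by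
  rw [EuclideanSpace.norm_eq]; rfl

lemma vnorm_sq {n : ℕ} (v : Fin n → ℂ) : vnorm v ^ 2 = ∑ j, ‖v j‖ ^ 2 :=
  Real.sq_sqrt (by positivity)

lemma vnorm_nonneg {n : ℕ} (v : Fin n → ℂ) : 0 ≤ vnorm v := Real.sqrt_nonneg _

lemma norm_apply_le_vnorm {n : ℕ} (v : Fin n → ℂ) (i : Fin n) : ‖v i‖ ≤ vnorm v := by
  rw [vnorm_eq_norm_toLp]
  exact PiLp.norm_apply_le (WithLp.toLp 2 v) i

lemma vnorm_smul {n : ℕ} (c : ℂ) (v : Fin n → ℂ) : vnorm (c • v) = ‖c‖ * vnorm v := by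
  rw [vnorm_eq_norm_toLp, vnorm_eq_norm_toLp, WithLp.toLp_smul, norm_smul]

open scoped Matrix.Norms.L2Operator in
lemma vnorm_mulVec_le_l2_norm {m n : ℕ} (A : Matrix (Fin m) (Fin n) ℂ) (v : Fin n → ℂ) :
    vnorm (A.mulVec v) ≤ ‖A‖ * vnorm v := by
  rw [vnorm_eq_norm_toLp, vnorm_eq_norm_toLp]
  exact Matrix.l2_opNorm_mulVec A (WithLp.toLp 2 v)

open scoped Matrix.Norms.L2Operator in
lemma bddAbove_vnorm_mulVec {m n : ℕ} (A : Matrix (Fin m) (Fin n) ℂ) :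
    BddAbove {c : ℝ | ∃ v : Fin n → ℂ, vnorm v ≤ 1 ∧ c = vnorm (A.mulVec v)} := by
  refine ⟨‖A‖, ?_⟩
  rintro _ ⟨v, hv, rfl⟩
  exact (vnorm_mulVec_le_l2_norm A v).trans (mul_le_of_le_one_right (norm_nonneg _) hv)

lemma vnorm_mulVec_le {m n : ℕ} (A : Matrix (Fin m) (Fin n) ℂ) (v : Fin n → ℂ) :
    vnorm (A.mulVec v) ≤ opNorm A * vnorm v := by
  rcases (vnorm_nonneg v).eq_or_lt with h0 | hpos
  · simpa [← h0] using vnorm_mulVec_le_l2_norm A v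
  · have hnorm : ‖((vnorm v : ℂ)⁻¹)‖ = (vnorm v)⁻¹ := by
      rw [norm_inv, Complex.norm_real, Real.norm_of_nonneg hpos.le]
    have h1 : vnorm (A.mulVec ((vnorm v : ℂ)⁻¹ • v)) ≤ opNorm A := by
      refine le_csSup (bddAbove_vnorm_mulVec A) ⟨_, ?_, rfl⟩
      rw [vnorm_smul, hnorm, inv_mul_cancel₀ hpos.ne']
    rw [Matrix.mulVec_smul, vnorm_smul, hnorm, inv_mul_le_iff₀ hpos] at h1
    linarith

lemma opNorm_nonneg {m n : ℕ} (A : Matrix (Fin m) (Fin n) ℂ) : 0 ≤ opNorm A := by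
  refine Real.sSup_nonneg ?_
  rintro _ ⟨v, -, rfl⟩
  exact vnorm_nonneg _

lemma schurNorm_nonneg {m n : ℕ} (X : Matrix (Fin m) (Fin n) ℂ) : 0 ≤ schurNorm X := by
  refine Real.sSup_nonneg ?_
  rintro _ ⟨A, -, rfl⟩
  exact opNorm_nonneg _

/-- Schur multiplication by a matrix whose columns lie in the unit ball is contractive. -/
lemma schurNorm_le_one {m n : ℕ} {X : Matrix (Fin m) (Fin n) ℂ}
    (hX : ∀ j, ∑ i, ‖X i j‖ ^ 2 ≤ 1) : schurNorm X ≤ 1 := by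
  refine Real.sSup_le ?_ zero_le_one
  rintro _ ⟨A, hA, rfl⟩
  refine Real.sSup_le ?_ zero_le_one
  rintro _ ⟨v, hv, rfl⟩
  have hrow (i : Fin m) :
      ‖(Matrix.hadamard X A).mulVec v i‖ ^ 2 ≤ ∑ j, ‖X i j‖ ^ 2 * ‖v j‖ ^ 2 := by
    have h1 : (Matrix.hadamard X A).mulVec v i = A.mulVec (fun j => X i j * v j) i := by
      simp only [Matrix.mulVec, dotProduct, Matrix.hadamard_apply]
      exact Finset.sum_congr rfl fun j _ => by ring
    have h2 : ‖A.mulVec (fun j => X i j * v j) i‖ ≤ vnorm (fun j => X i j * v j) :=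
      (norm_apply_le_vnorm _ i).trans <| (vnorm_mulVec_le A _).trans <|
        mul_le_of_le_one_left (vnorm_nonneg _) hA
    rw [h1]
    refine (pow_le_pow_left₀ (norm_nonneg _) h2 2).trans_eq ?_
    simp only [vnorm_sq, norm_mul, mul_pow]
  refine (sq_le_one_iff₀ (vnorm_nonneg _)).mp ?_
  calc vnorm ((Matrix.hadamard X A).mulVec v) ^ 2
      ≤ ∑ i, ∑ j, ‖X i j‖ ^ 2 * ‖v j‖ ^ 2 := by
        rw [vnorm_sq]; exact Finset.sum_le_sum fun i _ => hrow i
    _ = ∑ j, (∑ i, ‖X i j‖ ^ 2) * ‖v j‖ ^ 2 := by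
        rw [Finset.sum_comm]; simp only [Finset.sum_mul]
    _ ≤ ∑ j, ‖v j‖ ^ 2 :=
        Finset.sum_le_sum fun j _ => mul_le_of_le_one_left (by positivity) (hX j)
    _ = vnorm v ^ 2 := (vnorm_sq v).symm
    _ ≤ 1 := pow_le_one₀ (vnorm_nonneg v) hv

lemma schurNorm_le_one_of_mem_unitaryGroup {n : ℕ} {U : Matrix (Fin n) (Fin n) ℂ}
    (hU : U ∈ Matrix.unitaryGroup (Fin n) ℂ) : schurNorm U ≤ 1 := by
  refine schurNorm_le_one fun j => ?_
  have h : (Uᴴ * U) j j = 1 := by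
    rw [← star_eq_conjTranspose, Matrix.mem_unitaryGroup_iff'.mp hU, Matrix.one_apply_eq]
  simp only [Matrix.mul_apply, Matrix.conjTranspose_apply, RCLike.star_def,
    Complex.conj_mul'] at h
  exact le_of_eq (by exact_mod_cast h)

lemma mul_eq_of_isOrthProjOnto_ran {n k : ℕ} {P : Matrix (Fin n) (Fin n) ℂ}
    {G : Matrix (Fin n) (Fin k) ℂ} (hP : IsOrthProjOnto P (ran G)) : P * G = G := by
  refine Matrix.ext_of_mulVec_single fun i => ?_
  have hmem : G.mulVec (Pi.single i 1) ∈ ran P := by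
    rw [hP.2.2]; exact ⟨_, rfl⟩
  obtain ⟨w, hw⟩ := hmem
  rw [← Matrix.mulVec_mulVec, ← hw, Matrix.mulVecLin_apply, Matrix.mulVec_mulVec, hP.2.1]

lemma eq_one_of_posSemidef_of_mul_self {n : ℕ} {F : Matrix (Fin n) (Fin n) ℂ}
    (hF : F.PosSemidef) (h : F * F = 1) : F = 1 := by
  have hu : IsUnit (F + 1) := (Matrix.PosDef.posSemidef_add hF Matrix.PosDef.one).isUnit
  have h0 : (F + 1) * (F - 1) = 0 := by
    rw [add_mul, mul_sub, h]; simp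
  exact sub_eq_zero.mp (hu.mul_right_eq_zero.mp h0)

lemma re_trace_le_of_diag_le_one {n : ℕ} {A : Matrix (Fin n) (Fin n) ℂ}
    (h : ∀ i, A i i ≤ 1) : A.trace.re ≤ n := by
  have h1 : A.trace ≤ ∑ _i : Fin n, (1 : ℂ) := Finset.sum_le_sum fun i _ => h i
  simpa using (Complex.le_def.mp h1).1

/-- The equality case of the Cauchy–Schwarz inequality for the Hilbert–Schmidt inner product. -/
lemma eq_of_re_trace_le {n : ℕ} {A B : Matrix (Fin n) (Fin n) ℂ} {c : ℝ}
    (hA : (Aᴴ * A).trace.re ≤ c) (hB : (Bᴴ * B).trace.re ≤ c)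
    (hAB : c ≤ (Aᴴ * B).trace.re) : A = B := by
  have hBA : (Bᴴ * A).trace.re = (Aᴴ * B).trace.re := by
    have : Bᴴ * A = (Aᴴ * B)ᴴ := by simp
    rw [this, Matrix.trace_conjTranspose]; simp
  have hexp : ((A - B)ᴴ * (A - B)).trace.re
      = (Aᴴ * A).trace.re + (Bᴴ * B).trace.re - 2 * (Aᴴ * B).trace.re := by
    simp only [Matrix.conjTranspose_sub, sub_mul, mul_sub, Matrix.trace_sub, Complex.sub_re, hBA]
    ring
  have hnn := Complex.le_def.mp (Matrix.posSemidef_conjTranspose_mul_self (A - B)).trace_nonneg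
  refine sub_eq_zero.mp (Matrix.trace_conjTranspose_mul_self_eq_zero_iff.mp ?_)
  refine Complex.ext (le_antisymm ?_ hnn.1) hnn.2.symm
  rw [hexp, Complex.zero_re]; linarith

theorem stmt15 {n : ℕ} (U : Matrix (Fin n) (Fin n) ℂ)
    (hU : U ∈ Matrix.unitaryGroup (Fin n) ℂ)
    (F W G : Matrix (Fin n) (Fin n) ℂ) (h : IsSchurFact U F W G) :
    F = 1 ∧ G = 1 ∧ W = U := by
  obtain ⟨hF, hFd, hG, hGd, ⟨hWG, hWF⟩, hX⟩ := h
  rcases Nat.eq_zero_or_pos n with rfl | hn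
  · exact ⟨Subsingleton.elim _ _, Subsingleton.elim _ _, Subsingleton.elim _ _⟩
  have hUU : U * Uᴴ = 1 := Matrix.mem_unitaryGroup_iff.mp hU
  have hUU' : Uᴴ * U = 1 := Matrix.mem_unitaryGroup_iff'.mp hU
  have hs1 : schurNorm U ≤ 1 := schurNorm_le_one_of_mem_unitaryGroup hU
  have hs0 : 0 ≤ schurNorm U := schurNorm_nonneg U
  generalize schurNorm U = s at hX hs1 hs0
  have hWWG : Wᴴ * W * G = G := mul_eq_of_isOrthProjOnto_ran hWG
  have htr : s * (F * (W * G * Uᴴ)).trace.re = n := by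
    have h1 : (1 : Matrix (Fin n) (Fin n) ℂ) = (s : ℂ) • (F * (W * G * Uᴴ)) := by
      calc (1 : Matrix (Fin n) (Fin n) ℂ) = U * Uᴴ := hUU.symm
        _ = ((s : ℂ) • (F * W * G)) * Uᴴ := by rw [← hX]
        _ = _ := by simp only [Matrix.smul_mul, Matrix.mul_assoc]
    have h2 := congrArg (fun M => (Matrix.trace M).re) h1
    simpa [Matrix.trace_smul] using h2.symm
  have hn' : (0 : ℝ) < n := by exact_mod_cast hn
  have hFB : F = W * G * Uᴴ := by
    refine eq_of_re_trace_le (c := n) ?_ ?_ ?_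
    · rw [hF.isHermitian.eq]; exact re_trace_le_of_diag_le_one hFd
    · have h1 : (W * G * Uᴴ)ᴴ * (W * G * Uᴴ) = U * (G * (Wᴴ * W * G) * Uᴴ) := by
        simp only [Matrix.conjTranspose_mul, Matrix.conjTranspose_conjTranspose,
          hG.isHermitian.eq, Matrix.mul_assoc]
      rw [h1, Matrix.trace_mul_comm, hWWG, Matrix.mul_assoc, hUU', mul_one]
      exact re_trace_le_of_diag_le_one hGd
    · rw [hF.isHermitian.eq]
      have ht := pos_of_mul_pos_right (htr.symm ▸ hn') hs0
      exact htr ▸ mul_le_of_le_one_left ht.le hs1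
  have hWGU : W * G = F * U := by
    rw [hFB, Matrix.mul_assoc, hUU', mul_one]
  have hFs : (s : ℂ) • (F * F) = 1 := by
    calc (s : ℂ) • (F * F) = ((s : ℂ) • (F * (W * G))) * Uᴴ := by
          rw [hWGU, Matrix.smul_mul, ← Matrix.mul_assoc F, Matrix.mul_assoc, hUU, mul_one]
      _ = 1 := by rw [← Matrix.mul_assoc F, ← hX, hUU]
  have hs : s = 1 := by
    have h1 := congrArg (fun M => (M ⟨0, hn⟩ ⟨0, hn⟩).re) hFs
    have h2 := (Complex.le_def.mp (hFd ⟨0, hn⟩)).1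
    simp at h1 h2
    nlinarith
  subst hs
  have hF1 : F = 1 := eq_one_of_posSemidef_of_mul_self hF (by simpa using hFs)
  subst hF1
  have hWW : W * Wᴴ = 1 := by simpa using mul_eq_of_isOrthProjOnto_ran hWF
  rw [one_mul] at hWGU
  have hG1 : G = 1 := by
    refine eq_one_of_posSemidef_of_mul_self hG ?_
    calc G * G = (W * G)ᴴ * (W * G) := by
          rw [Matrix.conjTranspose_mul, hG.isHermitian.eq, Matrix.mul_assoc,
            ← Matrix.mul_assoc Wᴴ, hWWG]
      _ = 1 := by rw [hWGU, hUU']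
  exact ⟨rfl, hG1, by rw [← hWGU, hG1, mul_one]⟩

end MatFact
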